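/- Let A be a unital associative ring and let v₁, v₂, v₃, v₄ ∈ A² be such that each pair (vᵢ, vⱼ), i ≠ j, is a basis of the right A-module A². For each i fix ŵᵢ ∈ A² with (vᵢ, ŵᵢ) a basis of A², and let a_{i,j} ∈ A be the 𝒜-coordinates determined by v_j = ŵᵢ a_{i,j} + vᵢ r_{i,j} (each a_{i,j} is invertible). Then the two exchange (flip) relations hold: a_{2,4} = a_{2,1} a_{3,1}⁻¹ a_{3,4} + a_{2,3} a_{1,3}⁻¹ a_{1,4} and a_{4,2} = a_{4,1} a_{3,1}⁻¹ a_{3,2} + a_{4,3} a_{1,3}⁻¹ a_{1,2}. -/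

import Mathlib

/-- `(x, y)` is a basis of `A²` viewed as a right `A`-module: the map
`(a, b) ↦ x·a + y·b` is a bijection `A × A → A²`. -/
def IsBasis {A : Type*} [Ring A] (x y : Fin 2 → A) : Prop :=
  Function.Bijective fun p : A × A => fun i => x i * p.1 + y i * p.2

/-- Coordinates along `w` modulo `v` are right `A`-linear. -/
theorem IsBasis.coord_combination {A : Type*} [Ring A] {v w x y z : Fin 2 → A}
    (h : IsBasis v w) {a b c r s t α β : A}
    (hx : x = fun k => w k * a + v k * r) (hy : y = fun k => w k * b + v k * s)
    (hz : z = fun k => w k * c + v k * t) (hxyz : z = fun k => x k * α + y k * β) :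
    c = a * α + b * β := by
  have key : ((t, c) : A × A) = (r * α + s * β, a * α + b * β) := by
    apply h.1
    funext k
    have h₁ := congrFun hz k
    rw [hxyz, hx, hy] at h₁
    simp only [mul_add, add_mul, ← mul_assoc] at h₁ ⊢
    rw [add_comm, ← h₁]
    abel
  exact congrArg Prod.snd key

/-- If `(v, w)` and `(v, x)` are bases, the `w`-coordinate of `x` is invertible. -/
theorem IsBasis.isUnit_coord {A : Type*} [Ring A] {v w x : Fin 2 → A}
    (hw : IsBasis v w) (hx : IsBasis v x) {a r : A}
    (hd : x = fun k => w k * a + v k * r) : IsUnit a := by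
  obtain ⟨⟨s, t⟩, hst⟩ := hx.2 w
  have hst' : w = fun k => x k * t + v k * s := by
    rw [← hst]
    funext k
    exact add_comm _ _
  have h₁ : (1 : A) = a * t + 0 * s :=
    hw.coord_combination (z := w) (t := 0) hd (y := v) (s := 1) (by simp) (by simp) hst'
  have h₂ : (1 : A) = t * a + 0 * r :=
    hx.coord_combination (z := x) (t := 0) hst' (y := v) (s := 1) (by simp) (by simp) hd
  simp only [zero_mul, add_zero] at h₁ h₂
  exact ⟨⟨a, t, h₁.symm, h₂.symm⟩, rfl⟩

/-- The exchange relation for the coordinate of `z` relative to a fourth basis `(v, w)`. -/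
theorem IsBasis.exchange {A : Type*} [Ring A] {x y z v wx wy w : Fin 2 → A}
    (hxy : IsBasis x y) (hwx : IsBasis x wx) (hwy : IsBasis y wy) (hw : IsBasis v w)
    {axy axz ayx ayz ax ay az rxy rxz ryx ryz rx ry rz bxy byx : A}
    (dxy : y = fun k => wx k * axy + x k * rxy) (dxz : z = fun k => wx k * axz + x k * rxz)
    (dyx : x = fun k => wy k * ayx + y k * ryx) (dyz : z = fun k => wy k * ayz + y k * ryz)
    (dx : x = fun k => w k * ax + v k * rx) (dy : y = fun k => w k * ay + v k * ry)
    (dz : z = fun k => w k * az + v k * rz)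
    (hbyx : byx * ayx = 1) (hbxy : bxy * axy = 1) :
    az = ax * byx * ayz + ay * bxy * axz := by
  obtain ⟨⟨α, β⟩, hz⟩ := hxy.2 z
  have hz' := hz.symm
  have h₁ : axz = 0 * α + axy * β :=
    hwx.coord_combination (x := x) (r := 1) (by simp) dxy dxz hz'
  have h₂ : ayz = ayx * α + 0 * β :=
    hwy.coord_combination (y := y) (s := 1) dyx (by simp) dyz hz'
  have h₃ : az = ax * α + ay * β := hw.coord_combination dx dy dz hz'
  rw [h₃, h₁, h₂, zero_mul, zero_mul, zero_add, add_zero, mul_assoc ax, mul_assoc ay,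
    ← mul_assoc byx, ← mul_assoc bxy, hbyx, hbxy, one_mul, one_mul]

/-- Exchange (flip) relations for noncommutative `𝒜`-coordinates: given
`v₁, v₂, v₃, v₄ ∈ A²` pairwise forming bases of the right `A`-module `A²`,
`ŵᵢ` with `(vᵢ, ŵᵢ)` a basis, and `a_{i,j}` defined by `v_j = ŵᵢ a_{i,j} + vᵢ r_{i,j}`,
each `a_{i,j}` is invertible and
`a_{2,4} = a_{2,1} a_{3,1}⁻¹ a_{3,4} + a_{2,3} a_{1,3}⁻¹ a_{1,4}` and
`a_{4,2} = a_{4,1} a_{3,1}⁻¹ a_{3,2} + a_{4,3} a_{1,3}⁻¹ a_{1,2}`. -/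
theorem flip_relations {A : Type*} [Ring A]
    (v₁ v₂ v₃ v₄ w₁ w₂ w₃ w₄ : Fin 2 → A)
    (h12 : IsBasis v₁ v₂) (h13 : IsBasis v₁ v₃) (h14 : IsBasis v₁ v₄)
    (h23 : IsBasis v₂ v₃) (h24 : IsBasis v₂ v₄) (h34 : IsBasis v₃ v₄)
    (h21 : IsBasis v₂ v₁) (h31 : IsBasis v₃ v₁) (h41 : IsBasis v₄ v₁)
    (h32 : IsBasis v₃ v₂) (h42 : IsBasis v₄ v₂) (h43 : IsBasis v₄ v₃)
    (hw₁ : IsBasis v₁ w₁) (hw₂ : IsBasis v₂ w₂)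
    (hw₃ : IsBasis v₃ w₃) (hw₄ : IsBasis v₄ w₄)
    (a12 a13 a14 a21 a23 a24 a31 a32 a34 a41 a42 a43 : A)
    (r12 r13 r14 r21 r23 r24 r31 r32 r34 r41 r42 r43 : A)
    (hd12 : v₂ = fun k => w₁ k * a12 + v₁ k * r12)
    (hd13 : v₃ = fun k => w₁ k * a13 + v₁ k * r13)
    (hd14 : v₄ = fun k => w₁ k * a14 + v₁ k * r14)
    (hd21 : v₁ = fun k => w₂ k * a21 + v₂ k * r21)
    (hd23 : v₃ = fun k => w₂ k * a23 + v₂ k * r23)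
    (hd24 : v₄ = fun k => w₂ k * a24 + v₂ k * r24)
    (hd31 : v₁ = fun k => w₃ k * a31 + v₃ k * r31)
    (hd32 : v₂ = fun k => w₃ k * a32 + v₃ k * r32)
    (hd34 : v₄ = fun k => w₃ k * a34 + v₃ k * r34)
    (hd41 : v₁ = fun k => w₄ k * a41 + v₄ k * r41)
    (hd42 : v₂ = fun k => w₄ k * a42 + v₄ k * r42)
    (hd43 : v₃ = fun k => w₄ k * a43 + v₄ k * r43) :
    (IsUnit a12 ∧ IsUnit a13 ∧ IsUnit a14 ∧ IsUnit a21 ∧ IsUnit a23 ∧ IsUnit a24 ∧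
      IsUnit a31 ∧ IsUnit a32 ∧ IsUnit a34 ∧ IsUnit a41 ∧ IsUnit a42 ∧ IsUnit a43) ∧
      ∀ b31 b13 : A, a31 * b31 = 1 → b31 * a31 = 1 → a13 * b13 = 1 → b13 * a13 = 1 →
        a24 = a21 * b31 * a34 + a23 * b13 * a14 ∧
          a42 = a41 * b31 * a32 + a43 * b13 * a12 := by
  refine ⟨⟨hw₁.isUnit_coord h12 hd12, hw₁.isUnit_coord h13 hd13, hw₁.isUnit_coord h14 hd14,
    hw₂.isUnit_coord h21 hd21, hw₂.isUnit_coord h23 hd23, hw₂.isUnit_coord h24 hd24,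
    hw₃.isUnit_coord h31 hd31, hw₃.isUnit_coord h32 hd32, hw₃.isUnit_coord h34 hd34,
    hw₄.isUnit_coord h41 hd41, hw₄.isUnit_coord h42 hd42, hw₄.isUnit_coord h43 hd43⟩, ?_⟩
  intro b31 b13 _ hb31 _ hb13
  exact ⟨h13.exchange hw₁ hw₃ hw₂ hd13 hd14 hd31 hd34 hd21 hd23 hd24 hb31 hb13,
    h13.exchange hw₁ hw₃ hw₄ hd13 hd12 hd31 hd32 hd41 hd43 hd42 hb31 hb13⟩
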